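/- arXiv:1801.08994 — 2 statements merged into one kernel-verified Lean document; each statement's English description precedes it below -/
import Mathlib

section
/- Let n, p ≥ 1, let A_1, …, A_p be real symmetric n×n matrices, and let C be a real number such that Σ_{β=1}^{p} ‖A_β v‖² ≤ C ‖v‖² for every vector v ∈ ℝⁿ. Set S = Σ_{α=1}^{p} trace(A_α²). Then Σ_{α,β=1}^{p} N([A_α, A_β]) ≤ 4 C · S − (4/n) Σ_{α=1}^{p} (trace(A_α²))², where [A,B] = AB − BA and N(C) = trace(Cᵀ C) denotes the squared Frobenius norm. -/
open Matrix BigOperators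

/-- The squared Frobenius norm is the sum of the squares of the entries. -/
lemma trace_transpose_mul_self_eq_sum_sq {m n : Type*} [Fintype m] [Fintype n]
    (X : Matrix m n ℝ) : trace (Xᵀ * X) = ∑ j, ∑ i, X i j ^ 2 := by
  simp [trace, mul_apply, sq]

lemma trace_transpose_mul_self_real_nonneg {m n : Type*} [Fintype m] [Fintype n]
    (X : Matrix m n ℝ) : 0 ≤ trace (Xᵀ * X) := by
  rw [trace_transpose_mul_self_eq_sum_sq]
  positivity

lemma sq_trace_le_card_mul_trace_transpose_mul_self {n : Type*} [Fintype n]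
    (X : Matrix n n ℝ) : trace X ^ 2 ≤ Fintype.card n * trace (Xᵀ * X) := by
  calc trace X ^ 2 ≤ Fintype.card n * ∑ i, X i i ^ 2 :=
        sq_sum_le_card_mul_sum_sq (s := Finset.univ) (f := fun i => X i i)
    _ ≤ Fintype.card n * trace (Xᵀ * X) := by
        rw [trace_transpose_mul_self_eq_sum_sq]
        gcongr with j
        exact Finset.single_le_sum (f := fun i => X i j ^ 2) (fun i _ => sq_nonneg _)
          (Finset.mem_univ j)

lemma trace_commutator_le_of_isSymm {n : Type*} [Fintype n] {A B : Matrix n n ℝ}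
    (hA : A.IsSymm) (hB : B.IsSymm) :
    trace ((A * B - B * A)ᵀ * (A * B - B * A)) ≤ 4 * trace ((B * A)ᵀ * (B * A)) := by
  have h := trace_transpose_mul_self_real_nonneg (A * B + B * A)
  have hcomm : trace (B * A * (A * B)) = trace (A * B * (B * A)) := trace_mul_comm _ _
  simp only [transpose_sub, transpose_add, transpose_mul, hA.eq, hB.eq, sub_mul, mul_sub,
    add_mul, mul_add, trace_sub, trace_add] at h ⊢
  linarith

lemma sum_trace_transpose_mul_self_le_of_opBound {m n ι : Type*} [Fintype m] [Fintype n]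
    [Fintype ι] (B : ι → Matrix n n ℝ) (C : ℝ)
    (hC : ∀ v : n → ℝ, ∑ β, ∑ i, ((B β).mulVec v i) ^ 2 ≤ C * ∑ i, (v i) ^ 2)
    (X : Matrix n m ℝ) :
    ∑ β, trace ((B β * X)ᵀ * (B β * X)) ≤ C * trace (Xᵀ * X) := by
  simp only [trace_transpose_mul_self_eq_sum_sq]
  rw [Finset.sum_comm, Finset.mul_sum]
  exact Finset.sum_le_sum fun j _ => hC fun i => X i j

/-- Let `A_1, …, A_p` be real symmetric `n × n` matrices and `C : ℝ` with
`∑_β ‖A_β v‖² ≤ C ‖v‖²` for every `v : ℝⁿ`.  With `S = ∑_α trace(A_α²)`, one has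
`∑_{α,β} N([A_α, A_β]) ≤ 4 C S − (4/n) ∑_α (trace(A_α²))²`, where
`[A,B] = A*B − B*A` and `N(C) = trace (Cᵀ * C)` is the squared Frobenius norm. -/
theorem sum_sum_commutator_norm_le_of_opBound {n p : ℕ} (hn : 1 ≤ n) (hp : 1 ≤ p)
    (A : Fin p → Matrix (Fin n) (Fin n) ℝ) (hA : ∀ β, (A β).IsSymm) (C : ℝ)
    (hC : ∀ v : Fin n → ℝ, ∑ β, ∑ i, ((A β).mulVec v i) ^ 2 ≤ C * ∑ i, (v i) ^ 2)
    (S : ℝ) (hS : S = ∑ α, Matrix.trace ((A α) ^ 2)) :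
    ∑ α, ∑ β, Matrix.trace ((A α * A β - A β * A α)ᵀ * (A α * A β - A β * A α)) ≤
      4 * C * S - (4 / (n : ℝ)) * ∑ α, (Matrix.trace ((A α) ^ 2)) ^ 2 := by
  rw [hS, Finset.mul_sum, Finset.mul_sum, ← Finset.sum_sub_distrib]
  refine Finset.sum_le_sum fun α _ => ?_
  have hterm : ∀ β, trace ((A α * A β - A β * A α)ᵀ * (A α * A β - A β * A α)) ≤
      4 * trace ((A β * A α)ᵀ * (A β * A α)) -
        if α = β then 4 * trace ((A α * A α)ᵀ * (A α * A α)) else 0 := by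
    intro β
    split_ifs with h
    · subst h
      simp
    · simpa using trace_commutator_le_of_isSymm (hA α) (hA β)
  have hsum := Finset.sum_le_sum fun β (_ : β ∈ Finset.univ) => hterm β
  rw [Finset.sum_sub_distrib, ← Finset.mul_sum, Finset.sum_ite_eq,
    if_pos (Finset.mem_univ α)] at hsum
  have hop := sum_trace_transpose_mul_self_le_of_opBound A C hC (A α)
  have hsq := sq_trace_le_card_mul_trace_transpose_mul_self (A α * A α)
  rw [(hA α).eq] at hop
  rw [Fintype.card_fin] at hsq
  have hn0 : (0 : ℝ) < n := by exact_mod_cast hn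
  have hdiv : 4 / (n : ℝ) * trace (A α * A α) ^ 2 ≤
      4 * trace ((A α * A α)ᵀ * (A α * A α)) := by
    rw [div_mul_eq_mul_div, div_le_iff₀ hn0]
    linarith
  rw [pow_two (A α)]
  linarith
end

section
/- Let n ≥ 4 and p ≥ 1 be integers, let A_1, …, A_p be real symmetric n×n matrices satisfying trace(A_α A_β) = 0 for all α ≠ β, and let C be a real number such that Σ_{β=1}^{p} ‖A_β v‖² ≤ C ‖v‖² for every vector v ∈ ℝⁿ. Set S = Σ_{α=1}^{p} trace(A_α²) and σ_{αβ} = trace(A_α A_β). Then n S − Σ_{α,β=1}^{p} N([A_α, A_β]) − Σ_{α,β=1}^{p} σ_{αβ}² ≥ S ( n − 4C + ((4 − n)/n) S ), where [A,B] = AB − BA and N(C) = trace(Cᵀ C) denotes the squared Frobenius norm. -/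
open Matrix BigOperators

theorem trace_transpose_mul_self_eq_sum {m : Type*} [Fintype m] (X : Matrix m m ℝ) :
    trace (Xᵀ * X) = ∑ j, ∑ i, X i j ^ 2 := by
  simp only [trace, diag_apply, mul_apply, transpose_apply, sq]

/-- The squared Frobenius norm of a commutator of symmetric matrices is at most `4 tr(A²B²)`. -/
theorem trace_commutator_le {m : Type*} [Fintype m] {A B : Matrix m m ℝ}
    (hA : A.IsSymm) (hB : B.IsSymm) :
    trace ((A * B - B * A)ᵀ * (A * B - B * A)) ≤ 4 * trace ((B * A)ᵀ * (B * A)) := by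
  have hnonneg : 0 ≤ trace ((A * B + B * A)ᵀ * (A * B + B * A)) := by
    rw [trace_transpose_mul_self_eq_sum]
    positivity
  have hswap : trace ((A * B)ᵀ * (A * B)) = trace ((B * A)ᵀ * (B * A)) := by
    simp only [transpose_mul, hA.eq, hB.eq]
    exact trace_mul_comm _ _
  simp only [transpose_add, transpose_sub, add_mul, mul_add, sub_mul, mul_sub, trace_add,
    trace_sub] at hnonneg ⊢
  linarith

/-- For a real `n × n` matrix, `(tr A²)² ≤ n N(A²)`. -/
theorem sq_trace_mul_self_le {m : Type*} [Fintype m] (A : Matrix m m ℝ) :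
    trace (A * A) ^ 2 ≤ Fintype.card m * trace ((A * A)ᵀ * (A * A)) := by
  calc trace (A * A) ^ 2 ≤ Fintype.card m * ∑ j, (A * A) j j ^ 2 := by
        simpa [trace] using
          sq_sum_le_card_mul_sum_sq (s := Finset.univ) (f := fun j => (A * A) j j)
    _ ≤ Fintype.card m * trace ((A * A)ᵀ * (A * A)) := by
        rw [trace_transpose_mul_self_eq_sum]
        gcongr with j
        exact Finset.single_le_sum (f := fun i => (A * A) i j ^ 2)
          (fun i _ => sq_nonneg _) (Finset.mem_univ j)

/-- If `∑ ‖A_β v‖² ≤ C ‖v‖²` for all `v`, then `∑ N(A_β B) ≤ C N(B)` for every matrix `B`. -/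
theorem sum_trace_mul_le {m ι : Type*} [Fintype m] [Fintype ι] {A : ι → Matrix m m ℝ} {C : ℝ}
    (hC : ∀ v : m → ℝ, ∑ β, ∑ i, ((A β).mulVec v i) ^ 2 ≤ C * ∑ i, (v i) ^ 2)
    (B : Matrix m m ℝ) :
    ∑ β, trace ((A β * B)ᵀ * (A β * B)) ≤ C * trace (Bᵀ * B) := by
  simp only [trace_transpose_mul_self_eq_sum]
  rw [Finset.sum_comm, Finset.mul_sum]
  exact Finset.sum_le_sum fun j _ => hC fun i => B i j

/-- Algebraic core of the Simons-identity estimate: for `n ≥ 4`, `p ≥ 1`, real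
symmetric `n × n` matrices `A_1, …, A_p` with `trace (A_α * A_β) = 0` for
`α ≠ β`, and `C : ℝ` satisfying `∑_β ‖A_β v‖² ≤ C ‖v‖²` for every `v : ℝⁿ`,
setting `S = ∑_α trace(A_α²)` and `σ_{αβ} = trace (A_α * A_β)`, one has
`n S − ∑_{α,β} N([A_α, A_β]) − ∑_{α,β} σ_{αβ}² ≥ S (n − 4C + ((4 − n)/n) S)`. -/
theorem simons_identity_algebraic_core {n p : ℕ} (hn : 4 ≤ n) (hp : 1 ≤ p)
    (A : Fin p → Matrix (Fin n) (Fin n) ℝ) (hA : ∀ β, (A β).IsSymm)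
    (horth : ∀ α β, α ≠ β → Matrix.trace (A α * A β) = 0) (C : ℝ)
    (hC : ∀ v : Fin n → ℝ, ∑ β, ∑ i, ((A β).mulVec v i) ^ 2 ≤ C * ∑ i, (v i) ^ 2)
    (S : ℝ) (hS : S = ∑ α, Matrix.trace ((A α) ^ 2)) :
    (n : ℝ) * S
      - (∑ α, ∑ β,
          Matrix.trace ((A α * A β - A β * A α)ᵀ * (A α * A β - A β * A α)))
      - (∑ α, ∑ β, (Matrix.trace (A α * A β)) ^ 2) ≥
      S * ((n : ℝ) - 4 * C + ((4 - (n : ℝ)) / n) * S) := by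
  subst hS
  have hn0 : (0 : ℝ) < n := by exact_mod_cast (by omega : 0 < n)
  have hn4 : (4 : ℝ) ≤ n := by exact_mod_cast hn
  simp only [pow_two (A _)]
  set s : Fin p → ℝ := fun α => trace (A α * A α) with hs
  have hs0 : ∀ α, 0 ≤ s α := fun α => by
    have h := trace_transpose_mul_self_eq_sum (A α)
    rw [(hA α).eq] at h
    simp only [hs, h]
    positivity
  have hσ : ∀ α, ∑ β, trace (A α * A β) ^ 2 = s α ^ 2 := fun α =>
    Finset.sum_eq_single α (fun β _ h => by simp [horth α β h.symm]) (by simp)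
  have hcomm : ∀ α, ∑ β, trace ((A α * A β - A β * A α)ᵀ * (A α * A β - A β * A α)) ≤
      4 * C * s α - 4 / n * s α ^ 2 := fun α => by
    have hle := Finset.sum_le_sum fun β (_ : β ∈ Finset.univ.erase α) =>
      trace_commutator_le (hA α) (hA β)
    have htot := sum_trace_mul_le hC (A α)
    have hfour := sq_trace_mul_self_le (A α)
    rw [← Finset.add_sum_erase _ _ (Finset.mem_univ α)] at htot ⊢
    rw [← Finset.mul_sum] at hle
    rw [(hA α).eq] at htot
    rw [Fintype.card_fin] at hfour
    have hdiv : s α ^ 2 / n ≤ trace ((A α * A α)ᵀ * (A α * A α)) := by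
      rw [div_le_iff₀ hn0]
      linarith
    have hself : trace ((A α * A α - A α * A α)ᵀ * (A α * A α - A α * A α)) = 0 := by simp
    have hrw : 4 / (n : ℝ) * s α ^ 2 = 4 * (s α ^ 2 / n) := by ring
    rw [hself, hrw]
    linarith
  have hsum := Finset.sum_le_sum fun α (_ : α ∈ Finset.univ) => hcomm α
  rw [Finset.sum_sub_distrib, ← Finset.mul_sum, ← Finset.mul_sum] at hsum
  have hsq : ∑ α, s α ^ 2 ≤ (∑ α, s α) ^ 2 :=
    Finset.sum_sq_le_sq_sum_of_nonneg fun α _ => hs0 α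
  have hcoef : 0 ≤ 1 - 4 / (n : ℝ) := by
    rw [sub_nonneg, div_le_one hn0]
    exact hn4
  have hmul := mul_le_mul_of_nonneg_left hsq hcoef
  have hfrac : (4 - (n : ℝ)) / n = -(1 - 4 / (n : ℝ)) := by
    field_simp
    ring
  rw [Finset.sum_congr rfl fun α _ => hσ α, hfrac]
  linarith
end
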